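/- arXiv:1803.11472 — 3 statements merged into one kernel-verified Lean document; each statement's English description precedes it below -/
import Mathlib

section
/- Let T be a measure-preserving map of a probability space (X, μ), f : X → ℝ measurable, and (B_n) a sequence of positive reals tending to infinity such that S_n f / B_n (with S_n f = ∑_{k<n} f∘T^k) converges in distribution to a random variable Z that is not almost surely 0. Then B_{n+1}/B_n → 1. -/
open MeasureTheory Filter

noncomputable def hfun (z : ℝ) : ℝ := 1 - (1 + |z|)⁻¹

lemma hfun_cont : Continuous hfun := by
  unfold hfun
  refine continuous_const.sub (Continuous.inv₀ (by fun_prop) ?_)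
  intro z
  positivity

lemma hfun_nonneg (z : ℝ) : 0 ≤ hfun z := by
  unfold hfun
  have : (1 + |z|)⁻¹ ≤ 1 := inv_le_one_of_one_le₀ (by linarith [abs_nonneg z])
  linarith

lemma hfun_le_one (z : ℝ) : hfun z ≤ 1 := by
  unfold hfun
  have : 0 ≤ (1 + |z|)⁻¹ := by positivity
  linarith

lemma hfun_mono {x y : ℝ} (h : |x| ≤ |y|) : hfun x ≤ hfun y := by
  unfold hfun
  have : (1 + |y|)⁻¹ ≤ (1 + |x|)⁻¹ := by gcongr
  linarith

lemma hfun_strict {x y : ℝ} (h : |x| < |y|) : hfun x < hfun y := by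
  unfold hfun
  have : (1 + |y|)⁻¹ < (1 + |x|)⁻¹ := by gcongr
  linarith

lemma hfun_lip (x y : ℝ) : |hfun x - hfun y| ≤ |x - y| := by
  have hx := abs_nonneg x
  have hy := abs_nonneg y
  have e : hfun x - hfun y = (|x| - |y|) / ((1 + |x|) * (1 + |y|)) := by
    unfold hfun
    field_simp
    ring
  rw [e, abs_div]
  refine (div_le_self (abs_nonneg _) ?_).trans (abs_abs_sub_abs_le x y)
  rw [abs_of_pos (by positivity)]
  nlinarith [mul_nonneg hx hy]

noncomputable def hbcf (r : ℝ) : BoundedContinuousFunction ℝ ℝ :=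
  BoundedContinuousFunction.ofNormedAddCommGroup (fun z => hfun (r * z))
    (hfun_cont.comp (by fun_prop)) 1 (fun z => by
      rw [Real.norm_eq_abs, abs_of_nonneg (hfun_nonneg _)]; exact hfun_le_one _)

lemma hbcf_apply (r z : ℝ) : hbcf r z = hfun (r * z) := rfl

lemma hfun_int {X : Type*} [MeasurableSpace X] (μ : Measure X) [IsProbabilityMeasure μ]
    (u : X → ℝ) (hu : Measurable u) : Integrable (fun x => hfun (u x)) μ := by
  refine Integrable.of_bound (hfun_cont.measurable.comp hu).aestronglyMeasurable 1
    (Eventually.of_forall fun x => ?_)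
  rw [Real.norm_eq_abs, abs_of_nonneg (hfun_nonneg _)]
  exact hfun_le_one _

lemma hfun_int_lt (ν : Measure ℝ) [IsProbabilityMeasure ν] (hν : ν {0} < 1) {r s : ℝ}
    (hr : 0 ≤ r) (hrs : r < s) : ∫ z, hfun (r * z) ∂ν < ∫ z, hfun (s * z) ∂ν := by
  have i1 := hfun_int ν (fun z => r * z) (by fun_prop)
  have i2 := hfun_int ν (fun z => s * z) (by fun_prop)
  rw [← sub_pos, ← integral_sub i2 i1]
  refine (integral_pos_iff_support_of_nonneg (f := fun z => hfun (s * z) - hfun (r * z))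
    ?_ (i2.sub i1)).mpr ?_
  rotate_left
  · have hsub : ({0} : Set ℝ)ᶜ ⊆ Function.support
        (fun z => hfun (s * z) - hfun (r * z)) := by
      intro z hz
      have hz' : 0 < |z| := abs_pos.mpr hz
      have : hfun (r * z) < hfun (s * z) := by
        apply hfun_strict
        rw [abs_mul, abs_mul, abs_of_nonneg hr, abs_of_pos (hr.trans_lt hrs)]
        gcongr
      exact (sub_pos.mpr this).ne'
    refine lt_of_lt_of_le ?_ (measure_mono hsub)
    rw [prob_compl_eq_one_sub (measurableSet_singleton _)]
    exact tsub_pos_of_lt hν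
  · intro z
    simp only [Pi.zero_apply, sub_nonneg]
    apply hfun_mono
    rw [abs_mul, abs_mul, abs_of_nonneg hr, abs_of_pos (hr.trans_lt hrs)]
    gcongr

/-- If `T` preserves a probability measure `μ` and the normalized Birkhoff sums
`S_n f / B_n` converge in distribution to `ν`, which is not a Dirac mass at `0`,
then `B_{n+1}/B_n → 1`. -/
theorem stmt0 {X : Type*} [MeasurableSpace X] (μ : Measure X) [IsProbabilityMeasure μ]
    (T : X → X) (hT : MeasurePreserving T μ μ)
    (f : X → ℝ) (hf : Measurable f)
    (B : ℕ → ℝ) (hBpos : ∀ n, 0 < B n) (hBtop : Tendsto B atTop atTop)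
    (ν : Measure ℝ) [IsProbabilityMeasure ν] (hν : ν {0} < 1)
    (hconv : ∀ g : BoundedContinuousFunction ℝ ℝ,
      Tendsto (fun n => ∫ x, g ((∑ k ∈ Finset.range n, f (T^[k] x)) / B n) ∂μ)
        atTop (nhds (∫ z, g z ∂ν))) :
    Tendsto (fun n => B (n + 1) / B n) atTop (nhds 1) := by
  set S : ℕ → X → ℝ := fun n x => ∑ k ∈ Finset.range n, f (T^[k] x) with hS
  have hSm : ∀ n, Measurable (S n) := fun n =>
    Finset.measurable_sum _ fun k _ => hf.comp (hT.measurable.iterate k)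
  have hSs : ∀ n x, S (n + 1) x = S n (T x) + f x := by
    intro n x
    simp only [hS]
    rw [Finset.sum_range_succ']
    simp
  have hb : ∀ r : ℝ, Tendsto (fun n => ∫ x, hfun (r * (S (n + 1) x / B (n + 1))) ∂μ) atTop
      (nhds (∫ z, hfun (r * z) ∂ν)) := fun r =>
    (hconv (hbcf r)).comp (tendsto_add_atTop_nat 1)
  have h1 : Tendsto (fun n => ∫ x, hfun (S n x / B n) ∂μ) atTop
      (nhds (∫ z, hfun (1 * z) ∂ν)) := by
    have := hconv (hbcf 1)
    simp only [hbcf_apply] at this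
    simpa only [one_mul] using this
  have hd : Tendsto (fun n => ∫ x, (hfun (S (n + 1) x / B n) - hfun (S n (T x) / B n)) ∂μ) atTop
      (nhds (∫ _, (0 : ℝ) ∂μ)) := by
    refine tendsto_integral_of_dominated_convergence (fun _ => (1 : ℝ)) ?_
      (integrable_const _) ?_ ?_
    · intro n
      exact ((hfun_int μ _ ((hSm (n + 1)).div_const _)).sub
        (hfun_int μ _ (((hSm n).comp hT.measurable).div_const _))).aestronglyMeasurable
    · intro n
      refine Eventually.of_forall fun x => ?_
      rw [Real.norm_eq_abs, abs_le]
      constructor <;> linarith [hfun_nonneg (S (n + 1) x / B n), hfun_le_one (S (n + 1) x / B n),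
        hfun_nonneg (S n (T x) / B n), hfun_le_one (S n (T x) / B n)]
    · refine Eventually.of_forall fun x => ?_
      have hz : Tendsto (fun n => |f x| / B n) atTop (nhds 0) := hBtop.const_div_atTop _
      refine squeeze_zero_norm (fun n => ?_) hz
      rw [Real.norm_eq_abs]
      refine (hfun_lip _ _).trans (le_of_eq ?_)
      rw [hSs, ← sub_div, add_sub_cancel_left, abs_div, abs_of_pos (hBpos n)]
  have ha : Tendsto (fun n => ∫ x, hfun (S (n + 1) x / B n) ∂μ) atTop
      (nhds (∫ z, hfun (1 * z) ∂ν)) := by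
    have := hd.add h1
    rw [integral_zero, zero_add] at this
    refine this.congr fun n => ?_
    rw [integral_sub (hfun_int μ (fun x => S (n + 1) x / B n) ((hSm (n + 1)).div_const _))
        (hfun_int μ (fun x => S n (T x) / B n) (((hSm n).comp hT.measurable).div_const _))]
    have e : ∫ x, hfun (S n (T x) / B n) ∂μ = ∫ x, hfun (S n x / B n) ∂μ := by
      have hm : Measurable (fun y => hfun (S n y / B n)) :=
        hfun_cont.measurable.comp ((hSm n).div_const _)
      conv_rhs => rw [← hT.map_eq]
      rw [integral_map hT.aemeasurable hm.aestronglyMeasurable]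
    rw [e]
    ring
  have hcpos : ∀ n, 0 < B (n + 1) / B n := fun n => div_pos (hBpos _) (hBpos _)
  have key : ∀ n x, S (n + 1) x / B n = (B (n + 1) / B n) * (S (n + 1) x / B (n + 1)) := by
    intro n x
    have := (hBpos n).ne'
    have := (hBpos (n + 1)).ne'
    field_simp
  rw [tendsto_order]
  constructor
  · intro r hr
    rcases lt_or_ge r 0 with h0 | h0
    · exact Eventually.of_forall fun n => h0.trans (hcpos n)
    filter_upwards [(hb r).eventually_lt ha (hfun_int_lt ν hν h0 hr)] with n hn
    by_contra! hc
    refine hn.not_ge (integral_mono (hfun_int μ _ ((hSm (n + 1)).div_const _))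
      (hfun_int μ _ (((hSm (n + 1)).div_const _).const_mul r)) fun x => ?_)
    apply hfun_mono
    rw [key, abs_mul, abs_mul r, abs_of_pos (hcpos n), abs_of_nonneg h0]
    gcongr
  · intro r hr
    filter_upwards [ha.eventually_lt (hb r) (hfun_int_lt ν hν zero_le_one hr)] with n hn
    by_contra! hc
    refine hn.not_ge (integral_mono
      (hfun_int μ _ (((hSm (n + 1)).div_const _).const_mul r))
      (hfun_int μ _ ((hSm (n + 1)).div_const _)) fun x => ?_)
    apply hfun_mono
    rw [key, abs_mul, abs_mul (B (n + 1) / B n), abs_of_pos (hcpos n),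
      abs_of_nonneg (zero_le_one.trans hr.le)]
    gcongr
end

section
/- Let T be a conservative non-singular map of a σ-finite measure space (X, m), P ≪ m a probability measure, and (A_n) pairwise disjoint measurable sets. Then P(T^{-n} A_n) → 0 along a set of integers of density 1; i.e., there exists a set S ⊆ ℕ of natural density 1 such that P(T^{-n} A_n) → 0 as n → ∞ along S. -/
open MeasureTheory Filter

/-- A set of natural numbers has natural density one. -/
def HasDensityOne (S : Set ℕ) : Prop :=
  Tendsto (fun N : ℕ => (∑ n ∈ Finset.range N, Set.indicator S (fun _ => (1 : ℝ)) n) / N)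
    atTop (nhds 1)

lemma kvn (a : ℕ → ℝ) (h0 : ∀ n, 0 ≤ a n) (h1 : ∀ n, a n ≤ 1)
    (h : Tendsto (fun N : ℕ => (∑ n ∈ Finset.range N, a n) / N) atTop (nhds 0)) :
    ∃ S : Set ℕ, HasDensityOne S ∧ Tendsto a (atTop ⊓ Filter.principal S) (nhds 0) := by
  classical
  set b : ℕ → ℝ := fun N => (∑ n ∈ Finset.range N, a n) / N with hb
  have hb1 : ∀ N, b N ≤ 1 := by
    intro N
    refine div_le_one_of_le₀ ?_ (by positivity)
    calc _ ≤ ∑ n ∈ Finset.range N, (1:ℝ) := Finset.sum_le_sum fun n _ => h1 n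
      _ = N := by simp
  have hb0 : ∀ N, 0 ≤ b N := fun N => div_nonneg (Finset.sum_nonneg fun n _ => h0 n) (by positivity)
  set c : ℕ → ℝ := fun n => ⨆ i, b (n + i) with hc
  have hbdd : ∀ n, BddAbove (Set.range fun i => b (n + i)) := by
    intro n
    refine ⟨1, ?_⟩
    rintro _ ⟨i, rfl⟩
    exact hb1 _
  have hbc : ∀ n i, b (n + i) ≤ c n := fun n i => le_ciSup (hbdd n) i
  have hc0 : ∀ n, 0 ≤ c n := fun n => (hb0 _).trans (hbc n 0)
  have hanti : ∀ n N, n ≤ N → c N ≤ c n := by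
    intro n N hn
    refine ciSup_le fun i => ?_
    have := hbc n (N - n + i)
    rwa [← add_assoc, Nat.add_sub_cancel' hn] at this
  have hclim : Tendsto c atTop (nhds 0) := by
    rw [Metric.tendsto_atTop] at h ⊢
    intro ε hε
    obtain ⟨N0, hN0⟩ := h (ε / 2) (by positivity)
    refine ⟨N0, fun n hn => ?_⟩
    rw [Real.dist_eq, sub_zero, abs_of_nonneg (hc0 n)]
    have : c n ≤ ε / 2 := by
      refine ciSup_le fun i => ?_
      have := hN0 (n + i) (by omega)
      rw [Real.dist_eq, sub_zero] at this
      exact (le_abs_self _).trans this.le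
    linarith
  set s : ℕ → ℝ := fun n => Real.sqrt (c n + 1 / ((n : ℝ) + 1)) with hs
  have hslim : Tendsto s atTop (nhds 0) := by
    have := (hclim.add tendsto_one_div_add_atTop_nhds_zero_nat).sqrt
    simpa [hs] using this
  have hspos : ∀ n, 0 < s n := fun n => Real.sqrt_pos.2 (by have := hc0 n; positivity)
  have hsanti : ∀ n N, n ≤ N → s N ≤ s n := by
    intro n N hn
    refine Real.sqrt_le_sqrt (add_le_add (hanti n N hn) ?_)
    exact Nat.one_div_le_one_div hn
  refine ⟨{n | a n ≤ s n}, ?_, ?_⟩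
  · unfold HasDensityOne
    have key : ∀ N : ℕ, 0 < N → 1 - s N ≤
        (∑ n ∈ Finset.range N, Set.indicator {n | a n ≤ s n} (fun _ => (1 : ℝ)) n) / N := by
      intro N hN
      have hN' : (0:ℝ) < N := by exact_mod_cast hN
      have e1 : ∀ n ∈ Finset.range N, s N * (1 - Set.indicator {n | a n ≤ s n} (fun _ => (1 : ℝ)) n)
          ≤ a n := by
        intro n hn
        have := hsanti n N (Finset.mem_range.1 hn).le
        by_cases hx : a n ≤ s n
        · simp [hx, h0]
        · simp [hx]; linarith
      have e2 := Finset.sum_le_sum e1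
      rw [← Finset.mul_sum, Finset.sum_sub_distrib] at e2
      simp only [Finset.sum_const, Finset.card_range, nsmul_eq_mul, mul_one] at e2
      have e3 : ∑ n ∈ Finset.range N, a n = N * b N := by simp only [hb]; field_simp
      have e4 : b N ≤ s N * s N := by
        rw [Real.mul_self_sqrt (by have := hc0 N; positivity)]
        have := hbc N 0
        have : (0:ℝ) ≤ 1 / ((N:ℝ)+1) := by positivity
        simp only [add_zero] at *
        linarith
      rw [le_div_iff₀ hN']
      have e5 : s N * (N - ∑ n ∈ Finset.range N, Set.indicator {n | a n ≤ s n} (fun _ => (1 : ℝ)) n)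
          ≤ s N * (N * s N) := by
        calc _ ≤ _ := e2
          _ = N * b N := e3
          _ ≤ N * (s N * s N) := by gcongr
          _ = _ := by ring
      have := le_of_mul_le_mul_left e5 (hspos N)
      linarith
    refine tendsto_of_tendsto_of_tendsto_of_le_of_le' (g := fun N => 1 - s N) (h := fun _ => 1)
      (by simpa using hslim.const_sub 1) tendsto_const_nhds ?_ ?_
    · filter_upwards [eventually_gt_atTop 0] with N hN using key N hN
    · refine Eventually.of_forall fun N => div_le_one_of_le₀ ?_ (by positivity)
      calc _ ≤ ∑ n ∈ Finset.range N, (1:ℝ) := Finset.sum_le_sum fun n _ =>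
            Set.indicator_le_self' (fun _ _ => zero_le_one) n
        _ = N := by simp
  · refine tendsto_of_tendsto_of_tendsto_of_le_of_le' tendsto_const_nhds
      (hslim.mono_left inf_le_left) (Eventually.of_forall h0) ?_
    exact mem_inf_of_right (fun n hn => hn)

open scoped ENNReal

lemma comb {X : Type*} (T : X → X) (A : ℕ → Set X)
    (hdisj : Pairwise (Function.onFun Disjoint A)) (N K : ℕ) (x : X) :
    ∑ k ∈ Finset.range K, ∑ n ∈ Finset.range N,
      (A n).indicator (fun _ => (1 : ℝ≥0∞)) (T^[n] (T^[k] x)) ≤ (N + K : ℕ) := by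
  classical
  have : ∑ k ∈ Finset.range K, ∑ n ∈ Finset.range N,
      (A n).indicator (fun _ => (1 : ℝ≥0∞)) (T^[n] (T^[k] x)) =
      (((Finset.range K ×ˢ Finset.range N).filter (fun p => T^[p.2] (T^[p.1] x) ∈ A p.2)).card : ℕ) := by
    rw [← Finset.sum_product', Finset.card_filter]
    push_cast
    exact Finset.sum_congr rfl fun p _ => by simp [Set.indicator_apply]
  rw [this]
  have hle : ((Finset.range K ×ˢ Finset.range N).filter
      (fun p => T^[p.2] (T^[p.1] x) ∈ A p.2)).card ≤ (Finset.range (N + K)).card := by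
    refine Finset.card_le_card_of_injOn (fun p => p.2 + p.1) ?_ ?_
    · intro p hp
      simp at hp ⊢
      omega
    · intro p hp q hq h
      simp only [Finset.coe_filter, Set.mem_ofPred_eq, ← Function.iterate_add_apply] at hp hq
      simp only at h
      have h2 : p.2 = q.2 := by
        by_contra hne
        refine Set.disjoint_left.1 (hdisj hne) hp.2 ?_
        rw [h]; exact hq.2
      exact Prod.ext (by omega) h2
  rw [Finset.card_range] at hle
  exact_mod_cast hle

lemma dens_top {X : Type*} [MeasurableSpace X] (m : Measure X) [SigmaFinite m]
    (T : X → X) (hT : Conservative T m)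
    (P : Measure X) [IsProbabilityMeasure P] (hP : P ≪ m) :
    ∀ᵐ x ∂P, ∑' k, (P.map T^[k]).rnDeriv m x = ∞ := by
  have hTm : ∀ k, Measurable T^[k] := fun k => hT.measurable.iterate k
  have hac : ∀ k, P.map T^[k] ≪ m := fun k =>
    (hP.map (hTm k)).trans (hT.toQuasiMeasurePreserving.iterate k).absolutelyContinuous
  set D : X → ℝ≥0∞ := fun x => ∑' k, (P.map T^[k]).rnDeriv m x with hD
  have hDm : Measurable D := Measurable.ennreal_tsum fun k => Measure.measurable_rnDeriv _ _
  have key : ∀ C i : ℕ, ∀ᵐ x ∂P, x ∉ {x | D x ≤ C} ∩ spanningSets m i := by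
    intro C i
    set B := {x | D x ≤ C} ∩ spanningSets m i with hB
    have hBm : MeasurableSet B :=
      (measurableSet_le hDm measurable_const).inter (measurableSet_spanningSets m i)
    have hfin : ∫⁻ x in B, D x ∂m ≠ ∞ := by
      refine ne_of_lt (lt_of_le_of_lt (setLIntegral_mono (g := fun _ => (C : ℝ≥0∞)) measurable_const
        (fun x hx => hx.1)) ?_)
      rw [setLIntegral_const]
      exact ENNReal.mul_lt_top (by simp) ((measure_mono Set.inter_subset_right).trans_lt
        (measure_spanningSets_lt_top m i))
    have heq : ∫⁻ x in B, D x ∂m = ∑' k, P (T^[k] ⁻¹' B) := by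
      simp only [hD]
      rw [lintegral_tsum fun k => (Measure.measurable_rnDeriv _ _).aemeasurable]
      refine tsum_congr fun k => ?_
      rw [Measure.setLIntegral_rnDeriv (hac k), Measure.map_apply (hTm k) hBm]
    rw [heq] at hfin
    have h1 := ae_eventually_notMem hfin
    have h2 := hP.ae_le (hT.ae_mem_imp_frequently_image_mem hBm.nullMeasurableSet)
    filter_upwards [h1, h2] with x hx1 hx2 hxB
    exact hx2 hxB hx1
  have key' : ∀ᵐ x ∂P, ∀ C i : ℕ, x ∉ {x | D x ≤ C} ∩ spanningSets m i :=
    ae_all_iff.2 fun C => ae_all_iff.2 fun i => key C i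
  filter_upwards [key'] with x hx
  by_contra hne
  obtain ⟨C, hC⟩ := ENNReal.exists_nat_gt hne
  exact hx C (spanningSetsIndex m x) ⟨hC.le, mem_spanningSetsIndex m x⟩

lemma bound {X : Type*} [MeasurableSpace X] (m : Measure X) [SigmaFinite m]
    (T : X → X) (hT : Conservative T m)
    (P : Measure X) [IsProbabilityMeasure P] (hP : P ≪ m)
    (A : ℕ → Set X) (hA : ∀ n, MeasurableSet (A n))
    (hdisj : Pairwise (Function.onFun Disjoint A)) (δ : ℝ≥0∞) (hδ : δ ≠ 0) :
    ∃ K : ℕ, ∀ N : ℕ, ∑ n ∈ Finset.range N, P (T^[n] ⁻¹' A n) ≤ N * δ + δ * (N + K : ℕ) := by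
  have hTm : ∀ k, Measurable T^[k] := fun k => hT.measurable.iterate k
  have hac : ∀ k, P.map T^[k] ≪ m := fun k =>
    (hP.map (hTm k)).trans (hT.toQuasiMeasurePreserving.iterate k).absolutelyContinuous
  set d : ℕ → X → ℝ≥0∞ := fun k => (P.map T^[k]).rnDeriv m with hd
  have hdm : ∀ k, Measurable (d k) := fun k => Measure.measurable_rnDeriv _ _
  set f : X → ℝ≥0∞ := P.rnDeriv m with hf
  have hfm : Measurable f := Measure.measurable_rnDeriv _ _
  set E : ℕ → Set X := fun K => {x | δ * ∑ k ∈ Finset.range K, d k x < f x} with hE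
  have hEm : ∀ K, MeasurableSet (E K) := fun K =>
    measurableSet_lt (by fun_prop) hfm
  have hEanti : Antitone E := by
    intro K L hKL x hx
    have hx' : δ * ∑ k ∈ Finset.range L, d k x < f x := hx
    have hle : δ * ∑ k ∈ Finset.range K, d k x ≤ δ * ∑ k ∈ Finset.range L, d k x := by
      gcongr
    exact lt_of_le_of_lt hle hx'
  have hEinter : P (⋂ K, E K) = 0 := by
    rw [measure_eq_zero_iff_ae_notMem]
    filter_upwards [dens_top m T hT P hP, hP.ae_le (Measure.rnDeriv_lt_top P m)] with x hx hxf hmem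
    have h1 : δ * ∑' k, d k x ≤ f x := by
      rw [ENNReal.tsum_eq_iSup_nat, ENNReal.mul_iSup]
      exact iSup_le fun K => (Set.mem_iInter.1 hmem K).le
    rw [hx, ENNReal.mul_top hδ] at h1
    exact absurd hxf (not_lt.2 h1)
  have hlim : Tendsto (fun K => P (E K)) atTop (nhds 0) := by
    rw [← hEinter]
    exact tendsto_measure_iInter_atTop (fun K => (hEm K).nullMeasurableSet) hEanti
      ⟨0, measure_ne_top _ _⟩
  obtain ⟨K, hK⟩ := (hlim.eventually (gt_mem_nhds (pos_iff_ne_zero.2 hδ))).exists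
  refine ⟨K, fun N => ?_⟩
  set G : X → ℝ≥0∞ := fun x => ∑ n ∈ Finset.range N, (A n).indicator (fun _ => (1 : ℝ≥0∞)) (T^[n] x)
    with hG
  have hGm : Measurable G := Finset.measurable_sum _ fun n _ =>
    (measurable_const.indicator (hA n)).comp (hTm n)
  have hGN : ∀ x, G x ≤ N := by
    intro x
    calc _ ≤ ∑ n ∈ Finset.range N, (1:ℝ≥0∞) := Finset.sum_le_sum fun n _ =>
            Set.indicator_le_self' (fun _ _ => zero_le_one) _
        _ = N := by simp
  have hsum : ∑ n ∈ Finset.range N, P (T^[n] ⁻¹' A n) = ∫⁻ x, G x ∂P := by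
    simp only [hG]
    rw [lintegral_finsetSum (f := fun n x => (A n).indicator (fun _ => (1 : ℝ≥0∞)) (T^[n] x)) _
      fun n _ => (measurable_const.indicator (hA n)).comp (hTm n)]
    refine Finset.sum_congr rfl fun n _ => ?_
    rw [← lintegral_indicator_one ((hTm n) (hA n))]
    rfl
  rw [hsum, ← lintegral_add_compl G (hEm K)]
  refine add_le_add ?_ ?_
  · calc ∫⁻ x in E K, G x ∂P ≤ ∫⁻ x in E K, N ∂P := lintegral_mono fun x => hGN x
      _ = N * P (E K) := by rw [setLIntegral_const]
      _ ≤ N * δ := by gcongr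
  · have hPm : P = m.withDensity f := (Measure.withDensity_rnDeriv_eq P m hP).symm
    calc ∫⁻ x in (E K)ᶜ, G x ∂P = ∫⁻ x in (E K)ᶜ, f x * G x ∂m := by
          conv_lhs => rw [hPm]
          rw [setLIntegral_withDensity_eq_setLIntegral_mul _ hfm hGm (hEm K).compl]
          rfl
      _ ≤ ∫⁻ x in (E K)ᶜ, (δ * ∑ k ∈ Finset.range K, d k x) * G x ∂m := by
          refine setLIntegral_mono (by fun_prop) fun x hx => ?_
          gcongr
          exact not_lt.1 hx
      _ ≤ ∫⁻ x, (δ * ∑ k ∈ Finset.range K, d k x) * G x ∂m := setLIntegral_le_lintegral _ _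
      _ = δ * ∑ k ∈ Finset.range K, ∫⁻ x, d k x * G x ∂m := by
          simp only [mul_assoc, Finset.sum_mul]
          rw [lintegral_const_mul _ (by fun_prop), lintegral_finsetSum _ (by fun_prop)]
      _ = δ * ∑ k ∈ Finset.range K, ∫⁻ x, G (T^[k] x) ∂P := by
          congr 1
          refine Finset.sum_congr rfl fun k _ => ?_
          rw [← lintegral_map hGm (hTm k)]
          exact lintegral_rnDeriv_mul (hac k) hGm.aemeasurable
      _ = δ * ∫⁻ x, ∑ k ∈ Finset.range K, G (T^[k] x) ∂P := by
          rw [lintegral_finsetSum (f := fun k x => G (T^[k] x)) _ fun k _ => hGm.comp (hTm k)]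
      _ ≤ δ * ∫⁻ x, ((N + K : ℕ) : ℝ≥0∞) ∂P := by
          gcongr with x
          exact comb T A hdisj N K x
      _ = δ * (N + K : ℕ) := by simp

/-- For a conservative non-singular map `T` on a σ-finite measure space, a probability
measure `P ≪ m` and pairwise disjoint measurable sets `A_n`, the probabilities
`P(T^{-n} A_n)` tend to `0` along a set of integers of density one. -/
theorem stmt5 {X : Type*} [MeasurableSpace X] (m : Measure X) [SigmaFinite m]
    (T : X → X) (hT : Conservative T m)
    (P : Measure X) [IsProbabilityMeasure P] (hP : P ≪ m)
    (A : ℕ → Set X) (hA : ∀ n, MeasurableSet (A n))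
    (hdisj : Pairwise (Function.onFun Disjoint A)) :
    ∃ S : Set ℕ, HasDensityOne S ∧
      Tendsto (fun n : ℕ => (P (T^[n] ⁻¹' A n)).toReal) (atTop ⊓ Filter.principal S)
        (nhds 0) := by
  refine kvn _ (fun n => ENNReal.toReal_nonneg) (fun n => ?_) ?_
  · exact ENNReal.toReal_le_of_le_ofReal zero_le_one (by simpa using prob_le_one)
  rw [Metric.tendsto_atTop]
  intro ε hε
  obtain ⟨K, hK⟩ := bound m T hT P hP A hA hdisj (ENNReal.ofReal (ε / 4))
    (by simpa using hε)
  obtain ⟨N0, hN0⟩ := exists_nat_gt (K : ℝ)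
  refine ⟨N0, fun N hN => ?_⟩
  have hKN : (K : ℝ) < N := hN0.trans_le (by exact_mod_cast hN)
  have hNpos : (0:ℝ) < N := lt_of_le_of_lt (by positivity) hKN
  have h := ENNReal.toReal_mono (by finiteness) (hK N)
  rw [ENNReal.toReal_sum (fun n _ => measure_ne_top _ _),
    ENNReal.toReal_add (by finiteness) (by finiteness)] at h
  simp only [ENNReal.toReal_mul, ENNReal.toReal_natCast,
    ENNReal.toReal_ofReal (by positivity : (0:ℝ) ≤ ε / 4)] at h
  push_cast at h
  rw [Real.dist_eq, sub_zero, abs_of_nonneg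
    (div_nonneg (Finset.sum_nonneg fun n _ => ENNReal.toReal_nonneg) hNpos.le), div_lt_iff₀ hNpos]
  nlinarith
end

section
/- Let T be a conservative non-singular map of a σ-finite measure space (X, m), P ≪ m a probability measure, f : X → ℝ measurable, and (B_n) a sequence of positive reals with B_n → ∞ such that S_n f / B_n converges in distribution with respect to P to a random variable Z which is not a.s. 0. Then for every ρ > 0, B_n = o(e^{ρ n}). -/
open MeasureTheory Filter

open scoped ENNReal

noncomputable def dens {X : Type*} [MeasurableSpace X] (m : Measure X) (T : X → X)
    (μ : Measure X) (k : ℕ) : X → ℝ≥0∞ := (μ.map T^[k]).rnDeriv m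

theorem measurable_dens {X : Type*} [MeasurableSpace X] (m : Measure X) (T : X → X)
    (μ : Measure X) (k : ℕ) : Measurable (dens m T μ k) := Measure.measurable_rnDeriv _ _

theorem map_ac {X : Type*} [MeasurableSpace X] {m : Measure X}
    {T : X → X} (hT : Measure.QuasiMeasurePreserving T m m) {μ : Measure X}
    (hμ : μ ≪ m) (k : ℕ) : μ.map T^[k] ≪ m :=
  (hμ.map (hT.iterate k).measurable).trans (hT.iterate k).absolutelyContinuous

theorem setLIntegral_dens {X : Type*} [MeasurableSpace X] {m : Measure X} [SigmaFinite m]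
    {T : X → X} (hT : Measure.QuasiMeasurePreserving T m m) {μ : Measure X} [IsFiniteMeasure μ]
    (hμ : μ ≪ m) (k : ℕ) {s : Set X} (hs : MeasurableSet s) :
    ∫⁻ x in s, dens m T μ k x ∂m = μ (T^[k] ⁻¹' s) := by
  unfold dens
  rw [Measure.setLIntegral_rnDeriv (map_ac hT hμ k), Measure.map_apply (hT.iterate k).measurable hs]

theorem lintegral_dens_mul {X : Type*} [MeasurableSpace X] {m : Measure X} [SigmaFinite m]
    {T : X → X} (hT : Measure.QuasiMeasurePreserving T m m) {μ : Measure X} [IsFiniteMeasure μ]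
    (hμ : μ ≪ m) (k : ℕ) {u : X → ℝ≥0∞} (hu : Measurable u) :
    ∫⁻ x, dens m T μ k x * u x ∂m = ∫⁻ x, u (T^[k] x) ∂μ := by
  unfold dens
  rw [lintegral_rnDeriv_mul (map_ac hT hμ k) hu.aemeasurable,
    lintegral_map hu (hT.iterate k).measurable]

theorem dens_lt_top {X : Type*} [MeasurableSpace X] {m : Measure X} [SigmaFinite m]
    {T : X → X} {μ : Measure X} [IsFiniteMeasure μ]
    (k : ℕ) : ∀ᵐ x ∂m, dens m T μ k x < ∞ := Measure.rnDeriv_lt_top _ _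

theorem setLIntegral_sum_dens {X : Type*} [MeasurableSpace X] {m : Measure X} [SigmaFinite m]
    {T : X → X} (hT : Measure.QuasiMeasurePreserving T m m) {μ : Measure X} [IsFiniteMeasure μ]
    (hμ : μ ≪ m) (n : ℕ) {s : Set X} (hs : MeasurableSet s) :
    ∫⁻ x in s, ∑ k ∈ Finset.range n, dens m T μ k x ∂m
      = ∑ k ∈ Finset.range n, μ (T^[k] ⁻¹' s) := by
  rw [lintegral_finsetSum _ (fun k _ => measurable_dens m T μ k)]
  exact Finset.sum_congr rfl (fun k _ => setLIntegral_dens hT hμ k hs)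

theorem hopf_aux {X : Type*} [MeasurableSpace X] {m : Measure X} [SigmaFinite m]
    {T : X → X} (hT : Measure.QuasiMeasurePreserving T m m) {γ π : Measure X} [IsFiniteMeasure γ]
    [IsFiniteMeasure π] (hγ : γ ≪ m) (hπ : π ≪ m) (N : ℕ) :
    γ {x | ∃ n ≤ N, ∑ k ∈ Finset.range n, dens m T γ k x < ∑ k ∈ Finset.range n, dens m T π k x}
      ≤ π Set.univ := by
  set A : ℕ → X → ℝ≥0∞ := fun n x => ∑ k ∈ Finset.range n, dens m T γ k x with hA
  set B : ℕ → X → ℝ≥0∞ := fun n x => ∑ k ∈ Finset.range n, dens m T π k x with hB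
  have mA : ∀ n, Measurable (A n) := fun n =>
    Finset.measurable_fun_sum _ (fun k _ => measurable_dens m T γ k)
  have mB : ∀ n, Measurable (B n) := fun n =>
    Finset.measurable_fun_sum _ (fun k _ => measurable_dens m T π k)
  set F : X → ℝ≥0∞ := fun x => (Finset.range (N+1)).sup (fun n => B n x - A n x) with hF
  have mF : Measurable F := by
    have : F = fun x => ⨆ n ∈ Finset.range (N+1), (B n x - A n x) := by
      ext x; simp only [hF, Finset.sup_eq_iSup]
    rw [this]
    exact Measurable.biSup _ (Finset.countable_toSet _) (fun n _ => (mB n).sub (mA n))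
  set ψ := m.withDensity F with hψ
  have hFB : ∀ x, F x ≤ B N x := by
    intro x
    refine Finset.sup_le (fun n hn => tsub_le_self.trans ?_)
    exact Finset.sum_le_sum_of_subset (Finset.range_mono (by simpa [Nat.lt_succ_iff] using hn))
  have hBint : ∫⁻ x, B N x ∂m < ∞ := by
    have := setLIntegral_sum_dens hT hπ N MeasurableSet.univ
    rw [Measure.restrict_univ] at this
    change ∫⁻ x, ∑ k ∈ Finset.range N, dens m T π k x ∂m < ∞
    rw [this]
    exact ENNReal.sum_lt_top.2 (fun k _ => measure_lt_top _ _)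
  have hψfin : IsFiniteMeasure ψ := 
    isFiniteMeasure_withDensity ((lintegral_mono hFB).trans_lt hBint).ne
  have hψm : ψ ≪ m := withDensity_absolutelyContinuous _ _
  have key : ∀ n ≤ N, ∀ᵐ x ∂m, B (n+1) x + dens m T γ 0 x
      ≤ dens m T π 0 x + A (n+1) x + dens m T ψ 1 x := by
    intro n hn
    refine ae_le_of_forall_setLIntegral_le_of_sigmaFinite
      ((mB _).add (measurable_dens _ _ _ _)) (fun s hs _ => ?_)
    rw [lintegral_add_left (mB _), lintegral_add_left (f := fun x => dens m T π 0 x + A (n+1) x)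
        ((measurable_dens _ _ _ _).add (mA _)),
      lintegral_add_left (measurable_dens _ _ _ _), setLIntegral_dens hT hγ 0 hs,
      setLIntegral_dens hT hπ 0 hs, setLIntegral_dens hT hψm 1 hs]
    have h1 := setLIntegral_sum_dens hT hπ (n+1) hs
    have h2 := setLIntegral_sum_dens hT hγ (n+1) hs
    change ∫⁻ x in s, B (n+1) x ∂m = _ at h1
    change ∫⁻ x in s, A (n+1) x ∂m = _ at h2
    rw [h1, h2, Finset.sum_range_succ', Finset.sum_range_succ']
    have hs' := hT.measurable hs
    have h3 := setLIntegral_sum_dens hT hπ n hs'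
    have h4 := setLIntegral_sum_dens hT hγ n hs'
    change ∫⁻ x in T⁻¹' s, B n x ∂m = _ at h3
    change ∫⁻ x in T⁻¹' s, A n x ∂m = _ at h4
    have e : ∀ k, T^[k+1] ⁻¹' s = T^[k] ⁻¹' (T ⁻¹' s) := fun k => by
      rw [Function.iterate_succ', Set.preimage_comp]
    simp only [e]
    rw [← h3, ← h4]
    have h5 : ∫⁻ x in T⁻¹' s, B n x ∂m ≤ ∫⁻ x in T⁻¹' s, A n x ∂m + ψ (T⁻¹' s) := by
      rw [hψ, withDensity_apply _ hs', ← lintegral_add_left (mA _)]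
      refine lintegral_mono (fun x => ?_)
      refine tsub_le_iff_left.1 ?_
      exact Finset.le_sup (f := fun n => B n x - A n x) (by simp; omega)
    simp only [Function.iterate_zero, Set.preimage_id]
    calc _ ≤ (∫⁻ x in T⁻¹' s, A n x ∂m + ψ (T⁻¹' s)) + π s + γ s := by gcongr
      _ = _ := by ring
  set M : Set X := {x | 0 < F x} with hM
  have mM : MeasurableSet M := measurableSet_lt measurable_const mF
  have hMeq : {x | ∃ n ≤ N, A n x < B n x} = M := by
    ext x
    simp only [hM, hF, Set.mem_ofPred_eq, Finset.lt_sup_iff, Finset.mem_range, Nat.lt_succ_iff,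
      tsub_pos_iff_lt]
  change γ {x | ∃ n ≤ N, A n x < B n x} ≤ _
  rw [hMeq]
  have key2 : ∀ᵐ x ∂(m.restrict M), F x + dens m T γ 0 x ≤ dens m T π 0 x + dens m T ψ 1 x := by
    rw [ae_restrict_iff' mM]
    have hk : ∀ᵐ x ∂m, ∀ n, n ≤ N → B (n+1) x + dens m T γ 0 x
      ≤ dens m T π 0 x + A (n+1) x + dens m T ψ 1 x := by
      rw [ae_all_iff]; intro n
      by_cases h : n ≤ N
      · filter_upwards [key n h] with x hx _ using hx
      · exact Filter.Eventually.of_forall (fun x hx => absurd hx h)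
    have hfin : ∀ᵐ x ∂m, ∀ k, dens m T γ k x < ∞ := ae_all_iff.2 (fun k => dens_lt_top k)
    filter_upwards [hk, hfin] with x hx hx2 hxM
    obtain ⟨n, hn, hne⟩ := Finset.exists_mem_eq_sup (Finset.range (N+1)) ⟨0, by simp⟩
      (fun n => B n x - A n x)
    have hFx : F x = B n x - A n x := hne
    have hpos : A n x < B n x := by
      have : 0 < F x := hxM
      rw [hFx] at this; exact tsub_pos_iff_lt.1 this
    obtain _ | n := n
    · simp [hA, hB] at hpos
    have h1 := hx n (by simp at hn; omega)
    have hAf : A (n+1) x ≠ ∞ := (ENNReal.sum_lt_top.2 (fun k _ => hx2 k)).ne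
    rw [hFx]
    rw [← ENNReal.add_le_add_iff_right hAf]
    calc _ = (B (n+1) x - A (n+1) x + A (n+1) x) + dens m T γ 0 x := by ring
      _ = B (n+1) x + dens m T γ 0 x := by rw [tsub_add_cancel_of_le hpos.le]
      _ ≤ _ := h1
      _ = _ := by ring
  have h6 := lintegral_mono_ae key2
  rw [lintegral_add_left mF, lintegral_add_left (measurable_dens _ _ _ _),
    setLIntegral_dens hT hγ 0 mM, setLIntegral_dens hT hπ 0 mM, setLIntegral_dens hT hψm 1 mM,
    ← withDensity_apply _ mM] at h6
  simp only [Function.iterate_zero, Set.preimage_id] at h6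
  have h7 : ψ (T^[1] ⁻¹' M) ≤ ψ M := by
    rw [hψ, withDensity_apply _ mM]
    calc _ ≤ m.withDensity F Set.univ := measure_mono (Set.subset_univ _)
      _ = ∫⁻ x, F x ∂m := by rw [withDensity_apply _ MeasurableSet.univ, Measure.restrict_univ]
      _ = ∫⁻ x in M, F x ∂m := by
        rw [← lintegral_indicator mM]
        congr 1; ext x
        by_cases hx : x ∈ M
        · simp [hx]
        · simp only [hx, Set.indicator_of_notMem, not_false_eq_true]
          simpa [hM] using hx
  have h8 : ψ M + γ M ≤ ψ M + π Set.univ := by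
    calc _ ≤ π M + ψ (T^[1] ⁻¹' M) := h6
      _ ≤ π Set.univ + ψ M := add_le_add (measure_mono (Set.subset_univ _)) h7
      _ = _ := add_comm _ _
  exact (ENNReal.add_le_add_iff_left (measure_ne_top ψ M)).1 h8

theorem hopf {X : Type*} [MeasurableSpace X] {m : Measure X} [SigmaFinite m]
    {T : X → X} (hT : Measure.QuasiMeasurePreserving T m m) {γ π : Measure X} [IsFiniteMeasure γ]
    [IsFiniteMeasure π] (hγ : γ ≪ m) (hπ : π ≪ m) :
    γ {x | ∃ n, ∑ k ∈ Finset.range n, dens m T γ k x < ∑ k ∈ Finset.range n, dens m T π k x}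
      ≤ π Set.univ := by
  have : {x | ∃ n, ∑ k ∈ Finset.range n, dens m T γ k x < ∑ k ∈ Finset.range n, dens m T π k x}
     = ⋃ N, {x | ∃ n ≤ N, ∑ k ∈ Finset.range n, dens m T γ k x
          < ∑ k ∈ Finset.range n, dens m T π k x} := by
    ext x; simp only [Set.mem_ofPred_eq, Set.mem_iUnion]
    exact ⟨fun ⟨n, h⟩ => ⟨n, n, le_rfl, h⟩, fun ⟨_, n, _, h⟩ => ⟨n, h⟩⟩
  rw [this, Monotone.measure_iUnion]
  · exact iSup_le (hopf_aux hT hγ hπ)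
  · intro N N' h x ⟨n, hn, hx⟩
    exact ⟨n, hn.trans h, hx⟩

theorem numeric (h c : ℝ≥0∞) (a b : ℕ → ℝ≥0∞) (h0 : h ≠ 0) (h1 : h ≠ ∞) (c0 : c ≠ 0)
    (c1 : c ≠ ∞) (hb : ∀ k, b k ≠ ∞) (ha : ∀ k, a k ≠ ∞) (hbs : ∑' k, b k = ∞)
    (hr : ∑' k, a k * (h / (1 + b k)) ≠ ∞)
    (hab : ∀ n, c * ∑ k ∈ Finset.range n, b k ≤ ∑ k ∈ Finset.range n, a k) : False := by
  set r : ℕ → ℝ≥0∞ := fun k => a k * (h / (1 + b k)) with hrdef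
  have hb1 : ∀ k, 1 + b k ≠ ∞ := fun k => by simp [hb k]
  have har : ∀ k, h * a k = r k + r k * b k := by
    intro k
    have : h / (1 + b k) * (1 + b k) = h := ENNReal.div_mul_cancel (by simp) (hb1 k)
    calc h * a k = a k * (h / (1 + b k) * (1 + b k)) := by rw [this, mul_comm]
      _ = r k * (1 + b k) := by rw [hrdef]; ring
      _ = _ := by ring
  set d := h * c / 2 with hd
  have hd0 : d ≠ 0 := by simp [hd, h0, c0]
  have hd1 : d ≠ ∞ := by simpa [hd] using ENNReal.div_ne_top (ENNReal.mul_ne_top h1 c1) (by simp)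
  have hdd : h * c = d + d := by rw [hd, ENNReal.add_halves]
  have hr0 : ∀ᶠ k in atTop, r k < d :=
    (tendsto_order.1 (ENNReal.tendsto_atTop_zero_of_tsum_ne_top hr)).2 d (pos_iff_ne_zero.2 hd0)
  obtain ⟨J, hJ⟩ := eventually_atTop.1 hr0
  set C := ∑ k ∈ Finset.range J, h * a k + ∑' k, r k with hC
  have hCt : C ≠ ∞ := by
    refine ENNReal.add_ne_top.2 ⟨?_, hr⟩
    exact (ENNReal.sum_lt_top.2 (fun k _ => (ENNReal.mul_ne_top h1 (ha k)).lt_top)).ne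
  have hterm : ∀ k, h * a k ≤ (if k < J then h * a k else 0) + r k + d * b k := by
    intro k
    by_cases hk : k < J
    · rw [if_pos hk, add_assoc]; exact le_self_add
    · rw [if_neg hk, zero_add, har]
      gcongr
      exact (hJ k (not_lt.1 hk)).le
  have hsum : ∀ n, d * ∑ k ∈ Finset.range n, b k ≤ C := by
    intro n
    have hBf : d * ∑ k ∈ Finset.range n, b k ≠ ∞ :=
      ENNReal.mul_ne_top hd1 (ENNReal.sum_lt_top.2 (fun k _ => (hb k).lt_top)).ne
    rw [← ENNReal.add_le_add_iff_right hBf, ← add_mul, ← hdd, mul_assoc]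
    calc _ ≤ h * ∑ k ∈ Finset.range n, a k := by gcongr; exact hab n
      _ = ∑ k ∈ Finset.range n, h * a k := Finset.mul_sum _ _ _
      _ ≤ ∑ k ∈ Finset.range n, ((if k < J then h * a k else 0) + r k + d * b k) :=
        Finset.sum_le_sum (fun k _ => hterm k)
      _ ≤ _ := by
        rw [Finset.sum_add_distrib, Finset.sum_add_distrib, ← Finset.mul_sum]
        refine add_le_add ?_ le_rfl
        refine add_le_add ?_ (ENNReal.sum_le_tsum _)
        rw [← Finset.sum_filter]
        refine Finset.sum_le_sum_of_subset (fun k hk => ?_)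
        simp at hk ⊢; exact hk.2
  have : ∑' k, b k ≤ C / d := by
    rw [ENNReal.tsum_eq_iSup_nat]
    refine iSup_le (fun n => ?_)
    rw [ENNReal.le_div_iff_mul_le (Or.inl hd0) (Or.inl hd1), mul_comm]
    exact hsum n
  rw [hbs] at this
  exact (ENNReal.div_ne_top hCt hd0) (top_le_iff.1 this)

theorem sum_dens_top {X : Type*} [MeasurableSpace X] {m : Measure X} [IsFiniteMeasure m]
    {T : X → X} (hT : Conservative T m) {P : Measure X} [IsFiniteMeasure P]
    (hP : P ≪ m) : ∀ᵐ x ∂P, ∑' k, dens m T P k x = ∞ := by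
  have hq := hT.toQuasiMeasurePreserving
  have hN : ∀ N : ℕ, ∀ᵐ x ∂P, ¬ (∑' k, dens m T P k x ≤ (N : ℝ≥0∞)) := by
    intro N
    set Q : Set X := {x | ∑' k, dens m T P k x ≤ (N : ℝ≥0∞)} with hQ
    have mQ : MeasurableSet Q :=
      measurableSet_le (Measurable.tsum (fun k => measurable_dens m T P k)) measurable_const
    have h1 : ∑' k, P (T^[k] ⁻¹' Q) ≠ ∞ := by
      have : ∑' k, P (T^[k] ⁻¹' Q) = ∫⁻ x in Q, ∑' k, dens m T P k x ∂m := by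
        rw [lintegral_tsum (fun k => (measurable_dens m T P k).aemeasurable)]
        exact tsum_congr (fun k => (setLIntegral_dens hq hP k mQ).symm)
      rw [this]
      have h2 : ∫⁻ x in Q, ∑' k, dens m T P k x ∂m ≤ ∫⁻ x in Q, (N : ℝ≥0∞) ∂m :=
        setLIntegral_mono measurable_const (fun x hx => hx)
      refine (h2.trans_lt ?_).ne
      rw [setLIntegral_const]
      exact ENNReal.mul_lt_top (by simp) (measure_lt_top _ _)
    have h3 := ae_iff.1 (ae_eventually_notMem h1)
    have h4 := hP.ae_le (hT.ae_mem_imp_frequently_image_mem mQ.nullMeasurableSet)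
    filter_upwards [h4, ae_eventually_notMem h1] with x hx hx2 hxQ
    exact (hx hxQ) hx2
  filter_upwards [ae_all_iff.2 hN] with x hx
  by_contra hne
  obtain ⟨N, hN⟩ := ENNReal.exists_nat_gt hne
  exact hx N hN.le

theorem sum_weights_top {X : Type*} [MeasurableSpace X] {m : Measure X} [IsFiniteMeasure m]
    {T : X → X} (hT : Conservative T m) {P : Measure X} [IsFiniteMeasure P]
    (hP : P ≪ m) :
    ∀ᵐ x ∂P, ∑' k, (dens m T P 0 (T^[k] x) / (1 + dens m T P k (T^[k] x))) = ∞ := by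
  have hq := hT.toQuasiMeasurePreserving
  set w : ℕ → X → ℝ≥0∞ := fun k y => dens m T P 0 y / (1 + dens m T P k y) with hw
  have mw : ∀ k, Measurable (w k) := fun k =>
    (measurable_dens m T P 0).div (measurable_const.add (measurable_dens m T P k))
  have mwT : ∀ k, Measurable (fun x => w k (T^[k] x)) := fun k =>
    (mw k).comp (hq.iterate k).measurable
  have hN : ∀ N : ℕ, ∀ᵐ x ∂P, ¬ (∑' k, w k (T^[k] x) ≤ (N : ℝ≥0∞)) := by
    intro N
    set D : Set X := {x | ∑' k, w k (T^[k] x) ≤ (N : ℝ≥0∞)} with hD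
    have mD : MeasurableSet D :=
      measurableSet_le (Measurable.tsum mwT) measurable_const
    by_contra hcon
    have hPD : P D ≠ 0 := by
      intro h0; exact hcon (measure_eq_zero_iff_ae_notMem.1 h0)
    set γ := P.restrict D with hγ
    have hγP : γ ≪ P := Measure.restrict_le_self.absolutelyContinuous
    have hγm : γ ≪ m := hγP.trans hP
    have hint : ∫⁻ x, ∑' k, dens m T γ k x * w k x ∂m ≠ ∞ := by
      rw [lintegral_tsum (f := fun k x => dens m T γ k x * w k x)
        (fun k => ((measurable_dens m T γ k).mul (mw k)).aemeasurable)]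
      have : ∀ k, ∫⁻ x, dens m T γ k x * w k x ∂m = ∫⁻ x, w k (T^[k] x) ∂γ := fun k =>
        lintegral_dens_mul hq hγm k (mw k)
      simp only [this]
      rw [← lintegral_tsum (fun k => (mwT k).aemeasurable)]
      have h2 : ∫⁻ x in D, ∑' k, w k (T^[k] x) ∂P ≤ ∫⁻ x in D, (N : ℝ≥0∞) ∂P :=
        setLIntegral_mono measurable_const (fun x hx => hx)
      refine (h2.trans_lt ?_).ne
      rw [setLIntegral_const]
      exact ENNReal.mul_lt_top (by simp) (measure_lt_top _ _)
    have hae : ∀ᵐ x ∂m, ∑' k, dens m T γ k x * w k x < ∞ :=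
      ae_lt_top (Measurable.tsum (fun k => (measurable_dens m T γ k).mul (mw k))) hint
    -- the constant
    set U := P Set.univ with hU
    have hU0 : U ≠ 0 := fun h => hPD (measure_mono_null (Set.subset_univ _) h)
    have hUt : U ≠ ∞ := measure_ne_top _ _
    obtain ⟨c, hc0, hcU⟩ : ∃ c : ℝ≥0∞, 0 < c ∧ c * U < P D := by
      refine ⟨P D / 2 / U, ?_, ?_⟩
      · exact ENNReal.div_pos (by simpa using hPD) hUt
      · rw [ENNReal.div_mul_cancel hU0 hUt]
        exact ENNReal.half_lt_self hPD (measure_ne_top _ _)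
    have hct : c ≠ ∞ := by
      rintro rfl
      rw [ENNReal.top_mul hU0] at hcU
      exact not_top_lt hcU
    lift c to NNReal using hct
    set π := c • P with hπ
    have hπm : π ≪ m := (Measure.smul_absolutelyContinuous (c := c)).trans hP
    have hh := hopf hq hγm hπm
    have hpd : ∀ᵐ x ∂m, ∀ k, dens m T π k x = c * dens m T P k x := by
      rw [ae_all_iff]; intro k
      have : π.map T^[k] = c • P.map T^[k] := by
        rw [hπ, Measure.map_smul]
      unfold dens
      rw [this]
      have := Measure.rnDeriv_smul_left (P.map T^[k]) m c
      filter_upwards [this] with x hx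
      rw [hx]; rfl
    have hex : ∃ᵐ x ∂γ, ¬ ∃ n, ∑ k ∈ Finset.range n, dens m T γ k x
        < ∑ k ∈ Finset.range n, dens m T π k x := by
      intro hall
      simp only [not_not] at hall
      have h1 := measure_mono_ae (μ := γ) (s := Set.univ) (hall.mono (fun x hx _ => hx))
      have h2 : γ Set.univ = P D := by rw [hγ, Measure.restrict_apply_univ]
      have h3 : π Set.univ = c * U := by simp [hπ, hU]
      rw [h2] at h1
      rw [h3] at hh
      exact absurd (h1.trans hh) (not_le.2 hcU)
    have hfin : ∀ᵐ x ∂m, ∀ k, dens m T γ k x < ∞ := ae_all_iff.2 (fun k => dens_lt_top k)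
    have hfinP : ∀ᵐ x ∂m, ∀ k, dens m T P k x < ∞ := ae_all_iff.2 (fun k => dens_lt_top k)
    have hpos : ∀ᵐ x ∂P, 0 < dens m T P 0 x := by
      have := Measure.rnDeriv_pos hP
      simpa [dens] using this
    have hall : ∀ᵐ x ∂γ, (∑' k, dens m T γ k x * w k x < ∞) ∧
        (∀ k, dens m T π k x = c * dens m T P k x) ∧ (∀ k, dens m T γ k x < ∞) ∧
        (∀ k, dens m T P k x < ∞) ∧ 0 < dens m T P 0 x ∧ ∑' k, dens m T P k x = ∞ := by
      filter_upwards [hγm.ae_le hae, hγm.ae_le hpd, hγm.ae_le hfin, hγm.ae_le hfinP,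
        hγP.ae_le hpos, hγP.ae_le (sum_dens_top hT hP)] with x h1 h2 h3 h4 h5 h6
      exact ⟨h1, h2, h3, h4, h5, h6⟩
    obtain ⟨x, hx, h1, h2, h3, h4, h5, h6⟩ := (hex.and_eventually hall).exists
    refine numeric (dens m T P 0 x) c (fun k => dens m T γ k x) (fun k => dens m T P k x) h5.ne'
      (h4 0).ne hc0.ne' (by simp) (fun k => (h4 k).ne) (fun k => (h3 k).ne) h6 h1.ne (fun n => ?_)
    push Not at hx
    have := hx n
    simp only [h2, ← Finset.mul_sum] at this
    exact this
  filter_upwards [ae_all_iff.2 hN] with x hx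
  by_contra hne
  obtain ⟨N, hN⟩ := ENNReal.exists_nat_gt hne
  exact hx N hN.le

theorem main_fin {X : Type*} [MeasurableSpace X] {m : Measure X} [IsFiniteMeasure m]
    {T : X → X} (hT : Conservative T m) {P : Measure X} [IsFiniteMeasure P]
    (hP : P ≪ m) (ε C : ℝ≥0∞) (hε : ε ≠ 0) (hεt : ε ≠ ∞) (hC : C ≠ ∞) :
    ∃ K : ℕ, ∀ (E : ℕ → Set X) (D : Set X), (∀ k, MeasurableSet (E k)) → MeasurableSet D →
      (∀ x ∈ D, ∀ k < K, T^[k] x ∈ E k) → ε ≤ P D → C ≤ ∑ k ∈ Finset.range K, P (E k) := by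
  have hq := hT.toQuasiMeasurePreserving
  set w : ℕ → X → ℝ≥0∞ := fun k y => dens m T P 0 y / (1 + dens m T P k y) with hw
  have mw : ∀ k, Measurable (w k) := fun k =>
    (measurable_dens m T P 0).div (measurable_const.add (measurable_dens m T P k))
  have mwT : ∀ k, Measurable (fun x => w k (T^[k] x)) := fun k =>
    (mw k).comp (hq.iterate k).measurable
  have hε2 : ε / 2 ≠ 0 := by simpa using hε
  have hε2t : ε / 2 ≠ ∞ := ENNReal.div_ne_top hεt (by simp)
  set R := C / (ε / 2) with hR
  have hRt : R ≠ ∞ := ENNReal.div_ne_top hC hε2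
  set V : ℕ → Set X := fun K => {x | ∑ k ∈ Finset.range K, w k (T^[k] x) ≤ R} with hV
  have mS : ∀ K, Measurable (fun x => ∑ k ∈ Finset.range K, w k (T^[k] x)) := fun K =>
    Finset.measurable_fun_sum _ (fun k _ => mwT k)
  have mV : ∀ K, MeasurableSet (V K) := fun K => measurableSet_le (mS K) measurable_const
  have hVanti : Antitone V := by
    intro K K' h x hx
    have hx' : ∑ k ∈ Finset.range K', w k (T^[k] x) ≤ R := hx
    exact (Finset.sum_le_sum_of_subset (Finset.range_mono h)).trans hx'
  have hV0 : P (⋂ K, V K) = 0 := by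
    refine measure_eq_zero_iff_ae_notMem.2 ?_
    filter_upwards [sum_weights_top hT hP] with x hx hxV
    have : ∑' k, w k (T^[k] x) ≤ R := by
      rw [ENNReal.tsum_eq_iSup_nat]
      exact iSup_le (fun K => Set.mem_iInter.1 hxV K)
    change ∑' k, w k (T^[k] x) = ∞ at hx
    rw [hx] at this
    exact hRt (top_le_iff.1 this)
  have hlim : Tendsto (fun K => P (V K)) atTop (nhds 0) := by
    rw [← hV0]
    exact tendsto_measure_iInter_atTop (fun K => (mV K).nullMeasurableSet) hVanti
      ⟨0, measure_ne_top _ _⟩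
  obtain ⟨K, hK⟩ := ((tendsto_order.1 hlim).2 (ε / 2) (pos_iff_ne_zero.2 hε2)).exists
  refine ⟨K, fun E D mE mD hDE hDε => ?_⟩
  have hDV : ε / 2 ≤ P (D \ V K) := by
    have h1 : P D ≤ P (D \ V K) + P (V K) := by
      calc P D ≤ P ((D \ V K) ∪ V K) := measure_mono (by intro x hx; by_cases h : x ∈ V K <;> simp [h, hx])
        _ ≤ _ := measure_union_le _ _
    have h2 : ε / 2 + ε / 2 ≤ P (D \ V K) + ε / 2 := by
      rw [ENNReal.add_halves]
      exact hDε.trans (h1.trans (by gcongr))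
    exact (ENNReal.add_le_add_iff_right hε2t).1 h2
  calc C = R * (ε / 2) := by rw [hR, ENNReal.div_mul_cancel hε2 hε2t]
    _ ≤ R * P (D \ V K) := by gcongr
    _ = ∫⁻ x in D \ V K, R ∂P := by rw [setLIntegral_const]
    _ ≤ ∫⁻ x in D \ V K, ∑ k ∈ Finset.range K, (E k).indicator (w k) (T^[k] x) ∂P := by
      refine setLIntegral_mono ?_ (fun x hx => ?_)
      · exact Finset.measurable_fun_sum _ (fun k _ =>
          ((mw k).indicator (mE k)).comp (hq.iterate k).measurable)
      · have h1 : R < ∑ k ∈ Finset.range K, w k (T^[k] x) := not_le.1 hx.2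
        refine h1.le.trans (Finset.sum_le_sum (fun k hk => ?_))
        rw [Set.indicator_of_mem (hDE x hx.1 k (Finset.mem_range.1 hk))]
    _ ≤ ∫⁻ x, ∑ k ∈ Finset.range K, (E k).indicator (w k) (T^[k] x) ∂P :=
      setLIntegral_le_lintegral _ _
    _ = ∑ k ∈ Finset.range K, ∫⁻ x, (E k).indicator (w k) (T^[k] x) ∂P :=
      lintegral_finsetSum _ (fun k _ => ((mw k).indicator (mE k)).comp (hq.iterate k).measurable)
    _ ≤ _ := by
      refine Finset.sum_le_sum (fun k _ => ?_)
      rw [← lintegral_dens_mul hq hP k ((mw k).indicator (mE k))]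
      have h0 : P (E k) = ∫⁻ x in E k, dens m T P 0 x ∂m := by
        rw [setLIntegral_dens hq hP 0 (mE k)]; simp
      rw [h0, ← lintegral_indicator (mE k)]
      refine lintegral_mono (fun x => ?_)
      by_cases hx : x ∈ E k
      · simp only [hx, Set.indicator_of_mem, hw]
        rw [← mul_div_assoc, mul_comm, mul_div_assoc]
        refine mul_le_of_le_one_right' ?_
        refine ENNReal.div_le_of_le_mul ?_
        rw [one_mul]; exact le_add_self
      · simp [hx]

theorem main_lemma {X : Type*} [MeasurableSpace X] {m : Measure X} [SigmaFinite m]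
    {T : X → X} (hT : Conservative T m) {P : Measure X} [IsFiniteMeasure P]
    (hP : P ≪ m) (ε C : ℝ≥0∞) (hε : ε ≠ 0) (hεt : ε ≠ ∞) (hC : C ≠ ∞) :
    ∃ K : ℕ, ∀ (E : ℕ → Set X) (D : Set X), (∀ k, MeasurableSet (E k)) → MeasurableSet D →
      (∀ x ∈ D, ∀ k < K, T^[k] x ∈ E k) → ε ≤ P D → C ≤ ∑ k ∈ Finset.range K, P (E k) := by
  have hT' : Conservative T m.toFinite := hT.congr_ae (by rw [ae_toFinite])
  exact main_fin hT' (hP.trans (absolutelyContinuous_toFinite m)) ε C hε hεt hC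

theorem conv_lower {X : Type*} [MeasurableSpace X] (P : Measure X) [IsProbabilityMeasure P]
    (Y : ℕ → X → ℝ) (hY : ∀ n, Measurable (Y n))
    (ν : Measure ℝ) [IsProbabilityMeasure ν] (hν : ν {0} < 1)
    (hconv : ∀ g : BoundedContinuousFunction ℝ ℝ,
      Tendsto (fun n => ∫ x, g (Y n x) ∂P) atTop (nhds (∫ z, g z ∂ν))) :
    ∃ r : ℝ, 1 ≤ r ∧ ∃ ε : ℝ, 0 < ε ∧
      ∀ᶠ n in atTop, ENNReal.ofReal ε ≤ P {x | r⁻¹ < |Y n x| ∧ |Y n x| < r} := by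
  obtain ⟨q, hq⟩ : ∃ q : ℕ, ν {z | ((q : ℝ) + 1)⁻¹ < |z| ∧ |z| < (q : ℝ) + 1} ≠ 0 := by
    by_contra hcon
    push Not at hcon
    have h0 : ν {0}ᶜ = 0 := by
      refine measure_mono_null ?_ (measure_iUnion_null hcon)
      intro z hz
      have hz' : 0 < |z| := abs_pos.2 hz
      obtain ⟨q, hq⟩ := exists_nat_gt (max |z| |z|⁻¹)
      refine Set.mem_iUnion.2 ⟨q, ?_, ?_⟩
      · have h1 : |z|⁻¹ < q + 1 := (le_max_right _ _).trans_lt (hq.trans (lt_add_one _))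
        exact inv_lt_of_inv_lt₀ hz' h1
      · exact (le_max_left _ _).trans_lt (hq.trans (lt_add_one _))
    have h1 := prob_compl_eq_zero_iff (μ := ν) (MeasurableSet.singleton (0:ℝ))
    exact hν.ne (h1.1 h0)
  set r : ℝ := (q : ℝ) + 1 with hr
  let g : BoundedContinuousFunction ℝ ℝ :=
    BoundedContinuousFunction.ofNormedAddCommGroup
      (fun z => max 0 (min 1 (min (|z| - r⁻¹) (r - |z|)))) (by fun_prop) 1 (by
        intro z
        rw [Real.norm_eq_abs, abs_of_nonneg (le_max_left _ _)]
        exact max_le zero_le_one (min_le_left _ _))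
  have hg : ∀ z, g z = max 0 (min 1 (min (|z| - r⁻¹) (r - |z|))) := fun z => rfl
  have g0 : ∀ z, 0 ≤ g z := fun z => le_max_left _ _
  have g1 : ∀ z, g z ≤ 1 := fun z => max_le zero_le_one (min_le_left _ _)
  have hsupp : Function.support g = {z | r⁻¹ < |z| ∧ |z| < r} := by
    ext z
    rw [Function.mem_support, ← (g0 z).lt_iff_ne', hg]
    simp [lt_max_iff]
  have hint : 0 < ∫ z, g z ∂ν := by
    rw [integral_pos_iff_support_of_nonneg g0 (g.integrable ν), hsupp]
    exact pos_iff_ne_zero.2 hq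
  refine ⟨r, by simp [hr], (∫ z, g z ∂ν) / 2, half_pos hint, ?_⟩
  filter_upwards [(tendsto_order.1 (hconv g)).1 _ (half_lt_self hint)] with n hn
  have mU : MeasurableSet {x | r⁻¹ < |Y n x| ∧ |Y n x| < r} :=
    (measurableSet_lt measurable_const (hY n).abs).inter
      (measurableSet_lt (hY n).abs measurable_const)
  rw [ENNReal.ofReal_le_iff_le_toReal (measure_ne_top _ _)]
  refine hn.le.trans ?_
  change _ ≤ P.real _
  rw [← integral_indicator_one mU]
  refine integral_mono_of_nonneg (Filter.Eventually.of_forall (fun x => g0 _))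
    ((integrable_const (1:ℝ)).indicator mU) (Filter.Eventually.of_forall (fun x => ?_))
  by_cases hx : x ∈ {x | r⁻¹ < |Y n x| ∧ |Y n x| < r}
  · simp only [Set.indicator_of_mem hx]; exact g1 _
  · simp only [Set.indicator_of_notMem hx]
    have : Y n x ∉ Function.support g := by rw [hsupp]; exact hx
    exact (Function.notMem_support.1 this).le

theorem conv_tight {X : Type*} [MeasurableSpace X] (P : Measure X) [IsProbabilityMeasure P]
    (Y : ℕ → X → ℝ) (hY : ∀ n, Measurable (Y n))
    (ν : Measure ℝ) [IsProbabilityMeasure ν]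
    (hconv : ∀ g : BoundedContinuousFunction ℝ ℝ,
      Tendsto (fun n => ∫ x, g (Y n x) ∂P) atTop (nhds (∫ z, g z ∂ν)))
    (η : ℝ) (hη : 0 < η) :
    ∃ R : ℝ, 0 < R ∧ ∀ᶠ n in atTop, P.real {x | R ≤ |Y n x|} < η := by
  let g : ℕ → BoundedContinuousFunction ℝ ℝ := fun R =>
    BoundedContinuousFunction.ofNormedAddCommGroup
      (fun z => max 0 (min 1 (|z| - R))) (by fun_prop) 1 (by
        intro z
        rw [Real.norm_eq_abs, abs_of_nonneg (le_max_left _ _)]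
        exact max_le zero_le_one (min_le_left _ _))
  have hg : ∀ R z, g R z = max 0 (min 1 (|z| - R)) := fun R z => rfl
  have g0 : ∀ R z, 0 ≤ g R z := fun R z => le_max_left _ _
  have g1 : ∀ R z, g R z ≤ 1 := fun R z => max_le zero_le_one (min_le_left _ _)
  have hlim : Tendsto (fun R => ∫ z, g R z ∂ν) atTop (nhds (∫ z, (0:ℝ) ∂ν)) := by
    refine tendsto_integral_of_dominated_convergence (fun _ => (1:ℝ))
      (fun R => (g R).continuous.aestronglyMeasurable) (integrable_const _) ?_ ?_
    · intro R
      refine Filter.Eventually.of_forall (fun z => ?_)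
      rw [Real.norm_eq_abs, abs_of_nonneg (g0 _ _)]; exact g1 _ _
    · refine Filter.Eventually.of_forall (fun z => ?_)
      refine tendsto_const_nhds.congr' ?_
      obtain ⟨q, hq⟩ := exists_nat_gt |z|
      filter_upwards [eventually_ge_atTop q] with R hR
      have : (q:ℝ) ≤ R := by exact_mod_cast hR
      rw [hg, max_eq_left]
      exact (min_le_right _ _).trans (by linarith)
  rw [integral_zero] at hlim
  obtain ⟨R, hR⟩ := ((tendsto_order.1 hlim).2 η hη).exists
  refine ⟨(R:ℝ) + 1, by positivity, ?_⟩
  filter_upwards [(tendsto_order.1 (hconv (g R))).2 _ hR] with n hn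
  have mU : MeasurableSet {x | (R:ℝ) + 1 ≤ |Y n x|} :=
    measurableSet_le measurable_const (hY n).abs
  refine lt_of_le_of_lt ?_ hn
  rw [← integral_indicator_one mU]
  refine integral_mono_of_nonneg (Filter.Eventually.of_forall (fun x => ?_))
    (Integrable.of_bound ((g R).continuous.measurable.comp (hY n)).aestronglyMeasurable 1
      (Filter.Eventually.of_forall (fun x => ?_)))
    (Filter.Eventually.of_forall (fun x => ?_))
  · exact Set.indicator_nonneg (fun _ _ => zero_le_one) _
  · rw [Real.norm_eq_abs]
    change |g R (Y n x)| ≤ 1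
    rw [abs_of_nonneg (g0 _ _)]; exact g1 _ _
  · by_cases hx : x ∈ {x | (R:ℝ) + 1 ≤ |Y n x|}
    · simp only [Set.indicator_of_mem hx]
      change (1:ℝ) ≤ g R (Y n x)
      have hx' : (R:ℝ) + 1 ≤ |Y n x| := hx
      rw [hg]
      refine le_max_of_le_right (le_min le_rfl (by linarith))
    · simp only [Set.indicator_of_notMem hx]; exact g0 _ _

theorem star {X : Type*} [MeasurableSpace X] (m : Measure X) [SigmaFinite m]
    (T : X → X) (hT : Conservative T m)
    (P : Measure X) [IsProbabilityMeasure P] (hP : P ≪ m)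
    (S : ℕ → X → ℝ) (hS : ∀ n, Measurable (S n))
    (hSadd : ∀ n k x, k ≤ n → S n x = S k x + S (n - k) (T^[k] x))
    (B : ℕ → ℝ) (hBpos : ∀ n, 0 < B n) (hBtop : Tendsto B atTop atTop)
    (r : ℝ) (hr : 1 ≤ r) (ε : ℝ) (hε : 0 < ε)
    (hlow : ∀ᶠ n in atTop, ENNReal.ofReal ε ≤ P {x | r⁻¹ < |S n x / B n| ∧ |S n x / B n| < r})
    (C : ℝ≥0∞) (hC : C ≠ ∞) :
    ∃ K : ℕ, ∀ᶠ n in atTop, C ≤ ∑ k ∈ Finset.range K,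
      P {x | r⁻¹ / 2 * B n < |S (n - k) x| ∧ |S (n - k) x| < 2 * r * B n} := by
  have hr0 : 0 < r := by linarith
  have hri : 0 < r⁻¹ := inv_pos.2 hr0
  have hri1 : r⁻¹ ≤ 1 := inv_le_one_of_one_le₀ hr
  set e := ENNReal.ofReal ε with he
  have he0 : e ≠ 0 := by simpa [he] using hε
  have het : e ≠ ∞ := ENNReal.ofReal_ne_top
  obtain ⟨K, hK⟩ := main_lemma hT hP (e / 2) C (by simpa using he0)
    (ENNReal.div_ne_top het (by simp)) hC
  refine ⟨K, ?_⟩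
  set M : X → ℝ := fun x => ∑ k ∈ Finset.range K, |S k x| with hM
  have mM : Measurable M := Finset.measurable_fun_sum _ (fun k _ => (hS k).abs)
  have hMlim : TendstoInMeasure P (fun n x => M x / B n) atTop (fun _ => (0:ℝ)) := by
    refine tendstoInMeasure_of_tendsto_ae (fun n => (mM.div_const _).aestronglyMeasurable) ?_
    exact Filter.Eventually.of_forall (fun x => hBtop.const_div_atTop _)
  have hM2 := (tendstoInMeasure_iff_dist.1 hMlim) (r⁻¹ / 2) (by positivity)
  have hM3 := (tendsto_order.1 hM2).2 (e / 2) (ENNReal.half_pos he0)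
  filter_upwards [hlow, hM3, eventually_ge_atTop K] with n h1 h2 hnK
  have hBn := hBpos n
  set W := {x | r⁻¹ < |S n x / B n| ∧ |S n x / B n| < r} with hW
  set V := {x | r⁻¹ / 2 ≤ dist (M x / B n) 0} with hV
  have mYn : Measurable (fun x => |S n x / B n|) := ((hS n).div_const _).abs
  have mW : MeasurableSet W :=
    (measurableSet_lt measurable_const mYn).inter (measurableSet_lt mYn measurable_const)
  have mV : MeasurableSet V := measurableSet_le measurable_const
    ((mM.div_const _).dist measurable_const)
  refine hK (fun k => {x | r⁻¹ / 2 * B n < |S (n - k) x| ∧ |S (n - k) x| < 2 * r * B n}) (W \ V)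
    (fun k => (measurableSet_lt measurable_const (hS _).abs).inter
      (measurableSet_lt (hS _).abs measurable_const)) (mW.diff mV) ?_ ?_
  · rintro x ⟨⟨hx1, hx2⟩, hx3⟩ k hk
    have hx3' : M x / B n < r⁻¹ / 2 := by
      have : dist (M x / B n) 0 < r⁻¹ / 2 := not_le.1 hx3
      rw [Real.dist_0_eq_abs] at this
      exact (abs_lt.1 this).2
    rw [div_lt_iff₀ hBn] at hx3'
    rw [abs_div, abs_of_pos hBn] at hx1 hx2
    rw [lt_div_iff₀ hBn] at hx1
    rw [div_lt_iff₀ hBn] at hx2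
    have hk1 : |S k x| ≤ M x :=
      Finset.single_le_sum (f := fun k => |S k x|) (fun _ _ => abs_nonneg _)
        (Finset.mem_range.2 hk)
    have heq := hSadd n k x (by omega)
    have t1 : |S n x| ≤ |S k x| + |S (n-k) (T^[k] x)| := by rw [heq]; exact abs_add_le _ _
    have t2 : |S (n-k) (T^[k] x)| ≤ |S n x| + |S k x| := by
      have : S (n-k) (T^[k] x) = S n x - S k x := by rw [heq]; ring
      rw [this]; exact abs_sub _ _
    have hrB : r⁻¹ / 2 * B n ≤ r * B n := by
      apply mul_le_mul_of_nonneg_right _ hBn.le; linarith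
    constructor
    · change r⁻¹ / 2 * B n < |S (n-k) (T^[k] x)|
      nlinarith
    · change |S (n-k) (T^[k] x)| < 2 * r * B n
      nlinarith
  · have h3 : P W ≤ P (W \ V) + P V := by
      calc P W ≤ P ((W \ V) ∪ V) := measure_mono (by
              intro x hx; by_cases h : x ∈ V <;> simp [h, hx])
        _ ≤ _ := measure_union_le _ _
    have h4 : e / 2 + e / 2 ≤ P (W \ V) + e / 2 := by
      rw [ENNReal.add_halves]
      exact h1.trans (h3.trans (by gcongr))
    exact (ENNReal.add_le_add_iff_right (ENNReal.div_ne_top het (by simp))).1 h4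

theorem jump {X : Type*} [MeasurableSpace X]
    (P : Measure X) [IsProbabilityMeasure P]
    (S : ℕ → X → ℝ)
    (B : ℕ → ℝ) (hBpos : ∀ n, 0 < B n) (a b : ℝ) (ha : 0 < a)
    (htight : ∀ η : ℝ, 0 < η → ∃ R : ℝ, 0 < R ∧
      ∀ᶠ n in atTop, P.real {x | R ≤ |S n x / B n|} < η)
    (hstar : ∀ C : ℝ≥0∞, C ≠ ∞ → ∃ K : ℕ, ∀ᶠ n in atTop, C ≤ ∑ k ∈ Finset.range K,
      P {x | a * B n < |S (n - k) x| ∧ |S (n - k) x| < b * B n}) :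
    ∃ J : ℝ, 1 ≤ J ∧ ∀ᶠ n in atTop, ∃ i < n, B n ≤ J * B i := by
  obtain ⟨K, hK⟩ := hstar 2 (by simp)
  obtain ⟨R, hR, hRt⟩ := htight (1 / (K + 1)) (by positivity)
  refine ⟨max 1 (R / a), le_max_left _ _, ?_⟩
  obtain ⟨i0, hi0⟩ := eventually_atTop.1 hRt
  filter_upwards [hK, eventually_ge_atTop (i0 + K + 1)] with n hn hnK
  by_contra hcon
  push Not at hcon
  have hr : ∀ k, k + 1 < K →
      P.real {x | a * B n < |S (n - (k+1)) x| ∧ |S (n - (k+1)) x| < b * B n} ≤ 1 / (K + 1) := by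
    intro k hk
    refine le_trans (measureReal_mono ?_) (hi0 (n - (k+1)) (by omega)).le
    intro x hx
    have h1 := hcon (n - (k+1)) (by omega)
    have hB := hBpos (n - (k+1))
    change R ≤ |S (n - (k+1)) x / B (n - (k+1))|
    rw [abs_div, abs_of_pos hB, le_div_iff₀ hB]
    have h2 : R / a * B (n - (k+1)) < B n :=
      lt_of_le_of_lt (mul_le_mul_of_nonneg_right (le_max_right _ _) hB.le) h1
    have h3 : R * B (n - (k+1)) < a * B n := by
      have := mul_lt_mul_of_pos_left h2 ha
      calc _ = a * (R / a * B (n - (k+1))) := by field_simp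
        _ < _ := this
    exact (h3.trans hx.1).le
  have hn' : (2:ℝ) ≤ ∑ k ∈ Finset.range K,
      P.real {x | a * B n < |S (n - k) x| ∧ |S (n - k) x| < b * B n} := by
    have := ENNReal.toReal_mono (ENNReal.sum_lt_top.2 (fun k _ => measure_lt_top _ _)).ne hn
    rw [ENNReal.toReal_sum (fun k _ => measure_ne_top _ _)] at this
    simpa [Measure.real] using this
  obtain _ | K := K
  · norm_num at hn'
  rw [Finset.sum_range_succ'] at hn'
  have h5 : ∑ k ∈ Finset.range K,
      P.real {x | a * B n < |S (n - (k+1)) x| ∧ |S (n - (k+1)) x| < b * B n}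
      ≤ ∑ k ∈ Finset.range K, (1 / (((K+1 : ℕ) : ℝ) + 1)) :=
    Finset.sum_le_sum (fun k hk => hr k (by simpa using hk))
  have h6 : P.real {x | a * B n < |S (n - 0) x| ∧ |S (n - 0) x| < b * B n} ≤ 1 :=
    measureReal_le_one
  have h7 : ∑ k ∈ Finset.range K, (1 / (((K+1 : ℕ) : ℝ) + 1)) < 1 := by
    rw [Finset.sum_const, Finset.card_range, nsmul_eq_mul, mul_one_div, div_lt_one (by positivity)]
    push_cast; linarith
  linarith

theorem final {X : Type*} [MeasurableSpace X]
    (P : Measure X) [IsProbabilityMeasure P]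
    (S : ℕ → X → ℝ) (hS : ∀ n, Measurable (S n))
    (B : ℕ → ℝ) (hBpos : ∀ n, 0 < B n) (a b : ℝ) (ha : 0 < a) (hab : a < b)
    (hstar : ∀ C : ℝ≥0∞, C ≠ ∞ → ∃ K : ℕ, ∀ᶠ n in atTop, C ≤ ∑ k ∈ Finset.range K,
      P {x | a * B n < |S (n - k) x| ∧ |S (n - k) x| < b * B n})
    (J : ℝ) (hJ : 1 ≤ J) (hjump : ∀ᶠ n in atTop, ∃ i < n, B n ≤ J * B i)
    (ρ : ℝ) (hρ : 0 < ρ) :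
    Tendsto (fun n : ℕ => B n / Real.exp (ρ * n)) atTop (nhds 0) := by
  set Q := J * b / a with hQ
  have hb : 0 < b := ha.trans hab
  have hQ1 : 1 < Q := by
    rw [hQ, lt_div_iff₀ ha, one_mul]; nlinarith
  have hQ0 : 0 < Q := by linarith
  have haQ : a * Q = J * b := by rw [hQ]; field_simp
  obtain ⟨c, hc⟩ := exists_nat_gt (max 0 (2 * Real.log Q / ρ))
  have hc0 : (0:ℝ) < c := (le_max_left _ _).trans_lt hc
  have hc0' : 0 < c := by exact_mod_cast hc0
  have hcρ : Real.log Q / c ≤ ρ / 2 := by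
    have := (le_max_right _ _).trans_lt hc
    rw [div_lt_iff₀ hρ] at this
    rw [div_le_iff₀ hc0]; linarith
  obtain ⟨K, hK⟩ := hstar c (by simp)
  obtain ⟨n1, hn1⟩ := eventually_atTop.1 (hK.and (hjump.and (eventually_ge_atTop K)))
  obtain ⟨j0, hj0⟩ := pow_unbounded_of_one_lt (∑ i ∈ Finset.range n1, B i) hQ1
  have hsmall : ∀ i < n1, B i < Q ^ j0 := fun i hi =>
    (Finset.single_le_sum (f := B) (fun i _ => (hBpos i).le) (Finset.mem_range.2 hi)).trans_lt hj0
  set G : ℕ → ℕ → Set X := fun i j => {x | a * Q ^ j < |S i x| ∧ |S i x| < a * Q ^ (j+1)} with hG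
  have mG : ∀ i j, MeasurableSet (G i j) := fun i j =>
    (measurableSet_lt measurable_const (hS _).abs).inter
      (measurableSet_lt (hS _).abs measurable_const)
  have hdisj : ∀ i, Pairwise (Function.onFun Disjoint (G i)) := by
    intro i
    have hmono : Monotone (fun j : ℕ => a * Q ^ j) := fun j j' h =>
      mul_le_mul_of_nonneg_left (pow_le_pow_right₀ hQ1.le h) ha.le
    have := hmono.pairwise_disjoint_on_Ioo_succ
    intro j j' hjj
    have h1 := (this hjj).preimage (fun x => |S i x|)
    exact h1
  have hbound : ∀ N : ℕ, B N ≤ Q ^ (j0 + (N / c + 2)) := by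
    intro N
    by_contra hcon
    push Not at hcon
    set L := N / c + 2 with hL
    have hj : ∀ j ∈ Finset.Ico j0 (j0 + L),
        (c : ℝ≥0∞) ≤ ∑ i ∈ Finset.range (N+1), P (G i j) := by
      intro j hj
      rw [Finset.mem_Ico] at hj
      have hex : ∃ n, Q ^ j ≤ B n := ⟨N, (pow_le_pow_right₀ hQ1.le hj.2.le).trans hcon.le⟩
      classical
      set n := Nat.find hex with hn
      have hnB : Q ^ j ≤ B n := Nat.find_spec hex
      have hnN : n ≤ N := Nat.find_min' hex ((pow_le_pow_right₀ hQ1.le hj.2.le).trans hcon.le)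
      have hlt : ∀ i < n, B i < Q ^ j := fun i hi => not_le.1 (Nat.find_min hex hi)
      have hnn1 : n1 ≤ n := by
        by_contra h
        have := hsmall n (not_le.1 h)
        have h2 := pow_le_pow_right₀ hQ1.le hj.1
        linarith
      obtain ⟨h1, ⟨i, hi, hiB⟩, h3⟩ := hn1 n hnn1
      have hnB2 : B n ≤ J * Q ^ j :=
        hiB.trans (mul_le_mul_of_nonneg_left (hlt i hi).le (by linarith))
      refine h1.trans ?_
      have hsub : ∀ k, P {x | a * B n < |S (n - k) x| ∧ |S (n - k) x| < b * B n}
          ≤ P (G (n - k) j) := by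
        intro k
        refine measure_mono (fun x hx => ⟨?_, ?_⟩)
        · exact (mul_le_mul_of_nonneg_left hnB ha.le).trans_lt hx.1
        · refine hx.2.trans_le ?_
          calc b * B n ≤ b * (J * Q ^ j) := mul_le_mul_of_nonneg_left hnB2 hb.le
            _ = (a * Q) * Q ^ j := by rw [haQ]; ring
            _ = a * Q ^ (j+1) := by ring
      refine (Finset.sum_le_sum (fun k _ => hsub k)).trans ?_
      have hinj : Set.InjOn (fun k => n - k) (Finset.range K : Set ℕ) := by
        intro k hk k' hk' h
        simp at hk hk' h; omega
      rw [← Finset.sum_image (f := fun i => P (G i j)) hinj]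
      refine Finset.sum_le_sum_of_subset (fun i hi => ?_)
      simp only [Finset.mem_image, Finset.mem_range] at hi ⊢
      omega
    have h1 : ∑ j ∈ Finset.Ico j0 (j0 + L), (c : ℝ≥0∞)
        ≤ ∑ j ∈ Finset.Ico j0 (j0 + L), ∑ i ∈ Finset.range (N+1), P (G i j) :=
      Finset.sum_le_sum hj
    rw [Finset.sum_comm] at h1
    have h2 : ∑ i ∈ Finset.range (N+1), ∑ j ∈ Finset.Ico j0 (j0 + L), P (G i j)
        ≤ ∑ i ∈ Finset.range (N+1), 1 := by
      refine Finset.sum_le_sum (fun i _ => ?_)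
      rw [← measure_biUnion_finset (fun j _ j' _ h => hdisj i h) (fun j _ => mG i j)]
      exact prob_le_one
    have h3 := h1.trans h2
    simp only [Finset.sum_const, Nat.card_Ico, Finset.card_range, nsmul_eq_mul, mul_one] at h3
    have h4 : (j0 + L - j0) * c ≤ N + 1 := by exact_mod_cast h3
    rw [Nat.add_sub_cancel_left, hL] at h4
    have h5 := Nat.div_add_mod N c
    have h6 := Nat.mod_lt N hc0'
    have h7 : (N / c + 2) * c = c * (N / c) + 2 * c := by ring
    omega
  have hb2 : ∀ N : ℕ, B N / Real.exp (ρ * N) ≤ Q ^ (j0 + 2) * Real.exp (-(ρ/2) * N) := by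
    intro N
    rw [div_le_iff₀ (Real.exp_pos _), mul_assoc, ← Real.exp_add]
    refine (hbound N).trans ?_
    have : j0 + (N / c + 2) = (j0 + 2) + N / c := by ring
    rw [this, pow_add]
    refine mul_le_mul_of_nonneg_left ?_ (by positivity)
    rw [← Real.exp_log (pow_pos hQ0 (N / c)), Real.log_pow]
    refine Real.exp_le_exp.2 ?_
    have hlog : 0 ≤ Real.log Q := Real.log_nonneg hQ1.le
    have h8 : ((N / c : ℕ) : ℝ) ≤ (N : ℝ) / c := Nat.cast_div_le
    calc ((N / c : ℕ) : ℝ) * Real.log Q ≤ (N : ℝ) / c * Real.log Q :=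
          mul_le_mul_of_nonneg_right h8 hlog
      _ = N * (Real.log Q / c) := by ring
      _ ≤ N * (ρ / 2) := mul_le_mul_of_nonneg_left hcρ (by positivity)
      _ = _ := by ring
  have hexp : Tendsto (fun N : ℕ => Q ^ (j0 + 2) * Real.exp (-(ρ/2) * N)) atTop (nhds 0) := by
    rw [← mul_zero (Q ^ (j0+2))]
    refine Tendsto.const_mul _ (Real.tendsto_exp_atBot.comp ?_)
    exact tendsto_natCast_atTop_atTop.const_mul_atTop_of_neg (by linarith)
  exact squeeze_zero (fun N => div_nonneg (hBpos N).le (Real.exp_pos _).le) hb2 hexp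

/-- Main theorem: for a conservative non-singular map `T` of a σ-finite measure space,
a probability measure `P ≪ m`, and normalized Birkhoff sums `S_n f / B_n` converging
in distribution (w.r.t. `P`) to a limit which is not a.s. `0`, the normalizing sequence
satisfies `B_n = o(e^{ρn})` for every `ρ > 0`. -/
theorem stmt8 {X : Type*} [MeasurableSpace X] (m : Measure X) [SigmaFinite m]
    (T : X → X) (hT : Conservative T m)
    (P : Measure X) [IsProbabilityMeasure P] (hP : P ≪ m)
    (f : X → ℝ) (hf : Measurable f)
    (B : ℕ → ℝ) (hBpos : ∀ n, 0 < B n) (hBtop : Tendsto B atTop atTop)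
    (ν : Measure ℝ) [IsProbabilityMeasure ν] (hν : ν {0} < 1)
    (hconv : ∀ g : BoundedContinuousFunction ℝ ℝ,
      Tendsto (fun n => ∫ x, g ((∑ k ∈ Finset.range n, f (T^[k] x)) / B n) ∂P)
        atTop (nhds (∫ z, g z ∂ν))) :
    ∀ ρ : ℝ, 0 < ρ → Tendsto (fun n : ℕ => B n / Real.exp (ρ * n)) atTop (nhds 0) := by
  intro ρ hρ
  have hTm : ∀ k, Measurable (T^[k]) := fun k => hT.measurable.iterate k
  set S : ℕ → X → ℝ := fun n x => ∑ k ∈ Finset.range n, f (T^[k] x) with hSdef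
  have hS : ∀ n, Measurable (S n) := fun n =>
    Finset.measurable_fun_sum _ (fun k _ => hf.comp (hTm k))
  have hSadd : ∀ n k x, k ≤ n → S n x = S k x + S (n - k) (T^[k] x) := by
    intro n k x hk
    obtain ⟨l, rfl⟩ := Nat.exists_eq_add_of_le hk
    simp only [hSdef, Nat.add_sub_cancel_left, Finset.sum_range_add, ← Function.iterate_add_apply]
    congr 1
    exact Finset.sum_congr rfl (fun i _ => by rw [add_comm])
  have hY : ∀ n, Measurable (fun x => S n x / B n) := fun n => (hS n).div_const _
  obtain ⟨r, hr, ε, hε, hlow⟩ := conv_lower P (fun n x => S n x / B n) hY ν hν hconv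
  have htight := conv_tight P (fun n x => S n x / B n) hY ν hconv
  have hstar := star m T hT P hP S hS hSadd B hBpos hBtop r hr ε hε hlow
  have hr0 : 0 < r := by linarith
  have hri : 0 < r⁻¹ := inv_pos.2 hr0
  have hri1 : r⁻¹ ≤ 1 := inv_le_one_of_one_le₀ hr
  obtain ⟨J, hJ, hjump⟩ := jump P S B hBpos (r⁻¹ / 2) (2 * r) (by positivity) htight hstar
  exact final P S hS B hBpos (r⁻¹ / 2) (2 * r) (by positivity) (by linarith) hstar J hJ hjump ρ hρ
end
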